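/- For all integers p, q ≥ 1, the limit as s → ∞ of N(p,q;s) / s^(p+q-1) exists and equals c(p,q) / (p+q-1)!, where c(p,q) is the value at t = 1 of the numerator polynomial N_{p,q}(t), determined by the recursion c(p,q) = c(p-1,q) + c(p,q-1) + |p - q| · C(p+q-2, p-1) with c(p',q') = 0 whenever p' = 0 or q' = 0. -/

import Mathlib

/-- Transport cost of a discrete plan, with cost `|i - j|` between indices. -/
def discCost {p q : ℕ} (J : Fin p → Fin q → ℕ) : ℕ :=
  ∑ i : Fin p, ∑ j : Fin q, ((i : ℤ) - (j : ℤ)).natAbs * J i j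

/-- The discrete Earth Mover's Distance between compositions. -/
noncomputable def discEMD {p q : ℕ} (μ : Fin p → ℕ) (ν : Fin q → ℕ) : ℕ :=
  sInf {c | ∃ J : Fin p → Fin q → ℕ,
    (∀ i, ∑ j, J i j = μ i) ∧ (∀ j, ∑ i, J i j = ν j) ∧ c = discCost J}

/-- `N(p,q;s)`: the sum of the discrete EMD over all pairs of compositions. -/
noncomputable def Nsum (p q s : ℕ) : ℕ :=
  ∑ μ ∈ Finset.Nat.antidiagonalTuple p s, ∑ ν ∈ Finset.Nat.antidiagonalTuple q s, discEMD μ ν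

/-- `c(p,q) = N_{p,q}(1)`, defined by the recursion
`c(p,q) = c(p-1,q) + c(p,q-1) + |p-q|·C(p+q-2,p-1)`. -/
def cRec : ℕ → ℕ → ℕ
  | 0, _ => 0
  | _ + 1, 0 => 0
  | p + 1, q + 1 =>
      cRec p (q + 1) + cRec (p + 1) q + ((p : ℤ) - (q : ℤ)).natAbs * Nat.choose (p + q) p
termination_by p q => p + q

open Filter Topology

/-! ### Transport plans and their marginals -/

/-- The row marginal of a transport plan. -/
def rowSum {p q : ℕ} (J : Fin p → Fin q → ℕ) : Fin p → ℕ := fun i => ∑ j, J i j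

/-- The column marginal of a transport plan. -/
def colSum {p q : ℕ} (J : Fin p → Fin q → ℕ) : Fin q → ℕ := fun j => ∑ i, J i j

/-- The plan moving one unit of mass from `i` to `j`. -/
def unitPlan {p q : ℕ} (i : Fin p) (j : Fin q) : Fin p → Fin q → ℕ :=
  Pi.single i (Pi.single j 1)

section Plans

variable {p q : ℕ}

lemma rowSum_add (J K : Fin p → Fin q → ℕ) : rowSum (J + K) = rowSum J + rowSum K := by
  ext i; simp [rowSum, Finset.sum_add_distrib]

lemma colSum_add (J K : Fin p → Fin q → ℕ) : colSum (J + K) = colSum J + colSum K := by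
  ext j; simp [colSum, Finset.sum_add_distrib]

lemma discCost_add (J K : Fin p → Fin q → ℕ) :
    discCost (J + K) = discCost J + discCost K := by
  simp [discCost, mul_add, Finset.sum_add_distrib]

lemma unitPlan_apply (i i' : Fin p) (j j' : Fin q) :
    unitPlan i j i' j' = if i' = i then (if j' = j then 1 else 0) else 0 := by
  unfold unitPlan
  by_cases h : i' = i
  · subst h; simp [Pi.single_apply]
  · simp [h]

lemma rowSum_unitPlan (i : Fin p) (j : Fin q) : rowSum (unitPlan i j) = Pi.single i 1 := by
  ext i'; simp [rowSum, unitPlan_apply, Pi.single_apply]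

lemma colSum_unitPlan (i : Fin p) (j : Fin q) : colSum (unitPlan i j) = Pi.single j 1 := by
  ext j'; simp [colSum, unitPlan_apply, Pi.single_apply]

lemma discCost_unitPlan (i : Fin p) (j : Fin q) :
    discCost (unitPlan i j) = ((i : ℤ) - (j : ℤ)).natAbs := by
  simp [discCost, unitPlan_apply]

lemma exists_eq_add_unitPlan {J : Fin p → Fin q → ℕ} {i : Fin p} {j : Fin q} (h : J i j ≠ 0) :
    ∃ K, J = K + unitPlan i j := by
  refine ⟨J - unitPlan i j, ?_⟩
  ext i' j'
  simp only [Pi.add_apply, Pi.sub_apply, unitPlan_apply]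
  split_ifs with h1 h2
  · subst h1 h2; omega
  · rfl
  · rfl

lemma exists_eq_add_unitPlan_of_rowSum {J : Fin p → Fin q → ℕ} {i : Fin p}
    (h : rowSum J i ≠ 0) : ∃ j K, J = K + unitPlan i j := by
  obtain ⟨j, -, hj⟩ := Finset.exists_ne_zero_of_sum_ne_zero h
  exact ⟨j, exists_eq_add_unitPlan hj⟩

lemma exists_eq_add_unitPlan_of_colSum {J : Fin p → Fin q → ℕ} {j : Fin q}
    (h : colSum J j ≠ 0) : ∃ i K, J = K + unitPlan i j := by
  obtain ⟨i, -, hi⟩ := Finset.exists_ne_zero_of_sum_ne_zero h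
  exact ⟨i, exists_eq_add_unitPlan hi⟩

lemma exists_eq_add_single {n : ℕ} {μ : Fin n → ℕ} {s : ℕ} (h : ∑ i, μ i = s + 1) :
    ∃ (i : Fin n) (μ' : Fin n → ℕ), μ = μ' + Pi.single i 1 ∧ ∑ i, μ' i = s := by
  obtain ⟨i, -, hi⟩ := Finset.exists_ne_zero_of_sum_ne_zero (h.trans_ne s.succ_ne_zero)
  have hμ : μ = (μ - Pi.single i 1) + Pi.single i 1 := by
    ext k
    by_cases hk : k = i
    · subst hk; simp; omega
    · simp [hk]
  refine ⟨i, _, hμ, ?_⟩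
  rw [hμ] at h
  simpa [Finset.sum_add_distrib, -Pi.sub_apply] using h

lemma exists_plan (s : ℕ) (μ : Fin p → ℕ) (ν : Fin q → ℕ) (hμ : ∑ i, μ i = s)
    (hν : ∑ j, ν j = s) : ∃ J : Fin p → Fin q → ℕ, rowSum J = μ ∧ colSum J = ν := by
  induction s generalizing μ ν with
  | zero =>
    refine ⟨0, ?_, ?_⟩
    · ext i
      simpa [rowSum, eq_comm] using Finset.sum_eq_zero_iff.1 hμ i (Finset.mem_univ i)
    · ext j
      simpa [colSum, eq_comm] using Finset.sum_eq_zero_iff.1 hν j (Finset.mem_univ j)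
  | succ s ih =>
    obtain ⟨i, μ', rfl, hμ'⟩ := exists_eq_add_single hμ
    obtain ⟨j, ν', rfl, hν'⟩ := exists_eq_add_single hν
    obtain ⟨J, rfl, rfl⟩ := ih μ' ν' hμ' hν'
    exact ⟨J + unitPlan i j, by rw [rowSum_add, rowSum_unitPlan],
      by rw [colSum_add, colSum_unitPlan]⟩

/-! ### The Earth Mover's Distance -/

lemma discEMD_le (J : Fin p → Fin q → ℕ) : discEMD (rowSum J) (colSum J) ≤ discCost J :=
  Nat.sInf_le ⟨J, fun _ => rfl, fun _ => rfl, rfl⟩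

lemma exists_plan_discEMD (μ : Fin p → ℕ) (ν : Fin q → ℕ) (h : ∑ i, μ i = ∑ j, ν j) :
    ∃ J : Fin p → Fin q → ℕ, rowSum J = μ ∧ colSum J = ν ∧ discEMD μ ν = discCost J := by
  obtain ⟨K, hK, hK'⟩ := exists_plan _ μ ν h rfl
  obtain ⟨J, h1, h2, h3⟩ := Nat.sInf_mem (s := {c | ∃ J : Fin p → Fin q → ℕ,
    (∀ i, ∑ j, J i j = μ i) ∧ (∀ j, ∑ i, J i j = ν j) ∧ c = discCost J})
    ⟨_, K, congrFun hK, congrFun hK', rfl⟩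
  exact ⟨J, funext h1, funext h2, h3⟩

/-- Swapping lemma: a plan with mass in the last row and in the last column can be turned into
one that sends a unit from the last row to the last column, at no extra cost. -/
lemma exists_plan_remove_last (J : Fin (p + 1) → Fin (q + 1) → ℕ) (μ : Fin (p + 1) → ℕ)
    (ν : Fin (q + 1) → ℕ) (hμ : rowSum J = μ + Pi.single (Fin.last p) 1)
    (hν : colSum J = ν + Pi.single (Fin.last q) 1) :
    ∃ J' : Fin (p + 1) → Fin (q + 1) → ℕ, rowSum J' = μ ∧ colSum J' = ν ∧
      discCost J' + ((p : ℤ) - (q : ℤ)).natAbs ≤ discCost J := by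
  obtain ⟨j, K, rfl⟩ := exists_eq_add_unitPlan_of_rowSum (J := J) (i := Fin.last p) (by simp [hμ])
  rw [rowSum_add, rowSum_unitPlan, add_left_inj] at hμ
  rw [colSum_add, colSum_unitPlan] at hν
  by_cases hj : j = Fin.last q
  · subst hj
    exact ⟨K, hμ, add_right_cancel hν, by simp [discCost_add, discCost_unitPlan]⟩
  obtain ⟨i, L, rfl⟩ := exists_eq_add_unitPlan_of_colSum (J := K) (j := Fin.last q) (by
    have := congrFun hν (Fin.last q)
    simp [Ne.symm hj] at this
    omega)
  rw [colSum_add, colSum_unitPlan, add_right_comm, add_left_inj] at hν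
  rw [rowSum_add, rowSum_unitPlan] at hμ
  refine ⟨L + unitPlan i j, by rw [rowSum_add, rowSum_unitPlan, hμ],
    by rw [colSum_add, colSum_unitPlan, hν], ?_⟩
  simp only [discCost_add, discCost_unitPlan, Fin.val_last]
  have := i.is_le
  have := j.is_le
  omega

lemma discEMD_add_single_last (μ : Fin (p + 1) → ℕ) (ν : Fin (q + 1) → ℕ)
    (h : ∑ i, μ i = ∑ j, ν j) :
    discEMD (μ + Pi.single (Fin.last p) 1) (ν + Pi.single (Fin.last q) 1) =
      discEMD μ ν + ((p : ℤ) - (q : ℤ)).natAbs := by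
  apply le_antisymm
  · obtain ⟨J, rfl, rfl, hJ⟩ := exists_plan_discEMD μ ν h
    have := discEMD_le (J + unitPlan (Fin.last p) (Fin.last q))
    rwa [rowSum_add, colSum_add, rowSum_unitPlan, colSum_unitPlan, discCost_add,
      discCost_unitPlan, ← hJ] at this
  · obtain ⟨J, hμ, hν, hJ⟩ := exists_plan_discEMD (μ + Pi.single (Fin.last p) 1)
      (ν + Pi.single (Fin.last q) 1) (by simp [Finset.sum_add_distrib, h])
    obtain ⟨J', rfl, rfl, hc⟩ := exists_plan_remove_last J μ ν hμ hν
    rw [hJ]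
    exact (Nat.add_le_add_right (discEMD_le J') _).trans hc

lemma discEMD_snoc_zero_left (μ : Fin p → ℕ) (ν : Fin q → ℕ) :
    discEMD (Fin.snoc μ 0 : Fin (p + 1) → ℕ) ν = discEMD μ ν := by
  unfold discEMD
  congr 1
  ext c
  constructor
  · rintro ⟨J, h1, h2, rfl⟩
    have h0 : ∀ j, J (Fin.last p) j = 0 := by simpa using h1 (Fin.last p)
    refine ⟨fun i => J i.castSucc, fun i => by simpa using h1 i.castSucc, fun j => ?_, ?_⟩
    · simpa [Fin.sum_univ_castSucc, h0] using h2 j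
    · simp [discCost, Fin.sum_univ_castSucc, h0]
  · rintro ⟨J, h1, h2, rfl⟩
    refine ⟨Fin.snoc (α := fun _ => Fin q → ℕ) J 0, fun i => ?_, fun j => ?_, ?_⟩
    · refine Fin.lastCases ?_ (fun i => ?_) i <;> simp [h1]
    · simp [Fin.sum_univ_castSucc, h2]
    · simp [discCost, Fin.sum_univ_castSucc]

lemma discEMD_comm (μ : Fin p → ℕ) (ν : Fin q → ℕ) : discEMD μ ν = discEMD ν μ := by
  have key : ∀ {p q : ℕ} (J : Fin p → Fin q → ℕ), discCost J = discCost fun j i => J i j := by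
    intro p q J
    simp only [discCost]
    rw [Finset.sum_comm]
    exact Finset.sum_congr rfl fun j _ => Finset.sum_congr rfl fun i _ => by
      rw [← Int.natAbs_neg, neg_sub]
  unfold discEMD
  congr 1
  ext c
  constructor <;> rintro ⟨J, h1, h2, rfl⟩ <;> exact ⟨fun j i => J i j, h2, h1, key J⟩

lemma discEMD_snoc_zero_right (μ : Fin p → ℕ) (ν : Fin q → ℕ) :
    discEMD μ (Fin.snoc ν 0 : Fin (q + 1) → ℕ) = discEMD μ ν := by
  rw [discEMD_comm, discEMD_snoc_zero_left, discEMD_comm]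

end Plans

/-! ### Recursion for sums over compositions -/

open Finset.Nat (antidiagonalTuple mem_antidiagonalTuple)

/-- Splitting compositions according to whether the last part vanishes. -/
lemma sum_antidiagonalTuple_succ_succ {M : Type*} [AddCommMonoid M] (p s : ℕ)
    (f : (Fin (p + 1) → ℕ) → M) :
    ∑ μ ∈ antidiagonalTuple (p + 1) (s + 1), f μ =
      ∑ μ ∈ antidiagonalTuple p (s + 1), f (Fin.snoc μ 0) +
        ∑ μ ∈ antidiagonalTuple (p + 1) s, f (μ + Pi.single (Fin.last p) 1) := by
  rw [← Finset.sum_filter_add_sum_filter_not _ (fun μ => μ (Fin.last p) = 0)]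
  congr 1
  · refine Finset.sum_nbij' (fun μ => Fin.init μ) (fun μ => Fin.snoc μ 0) ?_ ?_ ?_ ?_ ?_
    · intro μ hμ
      simp only [Finset.mem_filter, mem_antidiagonalTuple, Fin.sum_univ_castSucc] at hμ
      simpa [mem_antidiagonalTuple, hμ.2, Fin.init] using hμ.1
    · intro μ hμ
      simpa [mem_antidiagonalTuple, Fin.sum_univ_castSucc] using hμ
    · intro μ hμ
      rw [← (Finset.mem_filter.1 hμ).2, Fin.snoc_init_self]
    · intro μ _
      simp
    · intro μ hμ
      rw [← (Finset.mem_filter.1 hμ).2, Fin.snoc_init_self]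
  · have hsub : ∀ μ : Fin (p + 1) → ℕ, μ (Fin.last p) ≠ 0 →
        μ - Pi.single (Fin.last p) 1 + Pi.single (Fin.last p) 1 = μ := by
      intro μ hμ
      refine tsub_add_cancel_of_le fun k => ?_
      by_cases hk : k = Fin.last p
      · subst hk; simp; omega
      · simp [hk]
    refine Finset.sum_nbij' (fun μ => μ - Pi.single (Fin.last p) 1)
      (fun μ => μ + Pi.single (Fin.last p) 1) ?_ ?_ ?_ ?_ ?_
    · intro μ hμ
      simp only [Finset.mem_filter, mem_antidiagonalTuple] at hμ ⊢
      have h := hμ.1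
      rw [← hsub μ hμ.2] at h
      simpa [Finset.sum_add_distrib, -Pi.sub_apply] using h
    · intro μ hμ
      simpa [mem_antidiagonalTuple, Finset.sum_add_distrib] using hμ
    · intro μ hμ
      exact hsub μ (Finset.mem_filter.1 hμ).2
    · intro μ _
      simp
    · intro μ hμ
      rw [hsub μ (Finset.mem_filter.1 hμ).2]

lemma card_antidiagonalTuple_succ_succ (p s : ℕ) :
    (antidiagonalTuple (p + 1) (s + 1)).card =
      (antidiagonalTuple p (s + 1)).card + (antidiagonalTuple (p + 1) s).card := by
  simpa only [Finset.card_eq_sum_ones] using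
    sum_antidiagonalTuple_succ_succ p s (fun _ => 1)

lemma Nsum_succ_succ (p q s : ℕ) :
    Nsum (p + 1) (q + 1) (s + 1) + Nsum p q (s + 1) =
      Nsum p (q + 1) (s + 1) + Nsum (p + 1) q (s + 1) + Nsum (p + 1) (q + 1) s +
        ((p : ℤ) - (q : ℤ)).natAbs *
          ((antidiagonalTuple (p + 1) s).card * (antidiagonalTuple (q + 1) s).card) := by
  have hdiag : ∑ μ ∈ antidiagonalTuple (p + 1) s, ∑ ν ∈ antidiagonalTuple (q + 1) s,
      discEMD (μ + Pi.single (Fin.last p) 1) (ν + Pi.single (Fin.last q) 1) =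
      Nsum (p + 1) (q + 1) s + ((p : ℤ) - (q : ℤ)).natAbs *
        ((antidiagonalTuple (p + 1) s).card * (antidiagonalTuple (q + 1) s).card) := by
    have : ∀ μ ∈ antidiagonalTuple (p + 1) s, ∀ ν ∈ antidiagonalTuple (q + 1) s,
        discEMD (μ + Pi.single (Fin.last p) 1) (ν + Pi.single (Fin.last q) 1) =
          discEMD μ ν + ((p : ℤ) - (q : ℤ)).natAbs := fun μ hμ ν hν =>
      discEMD_add_single_last μ ν
        ((mem_antidiagonalTuple.1 hμ).trans (mem_antidiagonalTuple.1 hν).symm)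
    rw [Finset.sum_congr rfl fun μ hμ => Finset.sum_congr rfl (this μ hμ)]
    simp only [Nsum, Finset.sum_add_distrib, Finset.sum_const, smul_eq_mul]
    ring
  have hcol : Nsum (p + 1) q (s + 1) = Nsum p q (s + 1) +
      ∑ μ ∈ antidiagonalTuple (p + 1) s, ∑ ν ∈ antidiagonalTuple q (s + 1),
        discEMD (μ + Pi.single (Fin.last p) 1) ν := by
    simp only [Nsum, sum_antidiagonalTuple_succ_succ p, discEMD_snoc_zero_left]
  have hall : Nsum (p + 1) (q + 1) (s + 1) = Nsum p (q + 1) (s + 1) +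
      (∑ μ ∈ antidiagonalTuple (p + 1) s, ∑ ν ∈ antidiagonalTuple q (s + 1),
        discEMD (μ + Pi.single (Fin.last p) 1) ν +
      ∑ μ ∈ antidiagonalTuple (p + 1) s, ∑ ν ∈ antidiagonalTuple (q + 1) s,
        discEMD (μ + Pi.single (Fin.last p) 1) (ν + Pi.single (Fin.last q) 1)) := by
    rw [← Finset.sum_add_distrib, Nsum, sum_antidiagonalTuple_succ_succ p]
    simp only [discEMD_snoc_zero_left]
    congr 1
    refine Finset.sum_congr rfl fun μ _ => ?_
    rw [sum_antidiagonalTuple_succ_succ q]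
    simp only [discEMD_snoc_zero_right]
  rw [hdiag] at hall
  omega

lemma Nsum_zero_left (q s : ℕ) : Nsum 0 q (s + 1) = 0 := by
  simp [Nsum]

lemma Nsum_zero_right (p s : ℕ) : Nsum p 0 (s + 1) = 0 := by
  simp [Nsum]

/-! ### Asymptotics -/

lemma tendsto_natCast_div_succ_pow (k : ℕ) :
    Tendsto (fun s : ℕ => ((s : ℝ) / ((s + 1 : ℕ) : ℝ)) ^ k) atTop (𝓝 1) := by
  have := (tendsto_natCast_div_add_atTop (1 : ℝ)).pow k
  simpa using this

lemma tendsto_succ_pow_sub_pow_div (k : ℕ) :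
    Tendsto (fun s : ℕ => (((s + 1 : ℕ) : ℝ) ^ (k + 1) - (s : ℝ) ^ (k + 1)) /
      ((s + 1 : ℕ) : ℝ) ^ k) atTop (𝓝 (k + 1)) := by
  have h : Tendsto (fun s : ℕ => ∑ i ∈ Finset.range (k + 1),
      ((s : ℝ) / ((s + 1 : ℕ) : ℝ)) ^ i) atTop (𝓝 (∑ _i ∈ Finset.range (k + 1), (1 : ℝ))) :=
    tendsto_finsetSum _ fun i _ => tendsto_natCast_div_succ_pow i
  simp only [Finset.sum_const, Finset.card_range, nsmul_eq_mul, mul_one, Nat.cast_add,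
    Nat.cast_one] at h
  refine h.congr fun s => ?_
  have hs : ((s : ℝ) + 1) ≠ 0 := by positivity
  have hs' : (s : ℝ) / (s + 1) - 1 ≠ 0 := by
    rw [div_sub_one hs]
    simp [hs]
  rw [geom_sum_eq (sub_ne_zero.1 hs'), div_eq_iff hs', div_pow]
  push_cast
  field_simp
  ring

/-- Stolz–Cesàro for powers. -/
lemma tendsto_div_pow_succ_of_sub {a : ℕ → ℝ} {k : ℕ} {L : ℝ}
    (h : Tendsto (fun s : ℕ => (a (s + 1) - a s) / ((s + 1 : ℕ) : ℝ) ^ k) atTop (𝓝 L)) :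
    Tendsto (fun s : ℕ => a s / (s : ℝ) ^ (k + 1)) atTop (𝓝 (L / (k + 1))) := by
  set g : ℕ → ℝ := fun s => ((s + 1 : ℕ) : ℝ) ^ (k + 1) - (s : ℝ) ^ (k + 1)
  have hgpos : ∀ s, 0 < g s := fun s => by
    have : (s : ℝ) < ((s + 1 : ℕ) : ℝ) := by simp
    exact sub_pos.2 (pow_lt_pow_left₀ this (by positivity) k.succ_ne_zero)
  have hgsum : ∀ n, ∑ s ∈ Finset.range n, g s = (n : ℝ) ^ (k + 1) := fun n => by
    rw [Finset.sum_range_sub (fun s : ℕ => (s : ℝ) ^ (k + 1))]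
    simp
  have hk : (k + 1 : ℝ) ≠ 0 := by positivity
  have hpow : Tendsto (fun n : ℕ => (n : ℝ) ^ (k + 1)) atTop atTop :=
    (tendsto_pow_atTop k.succ_ne_zero).comp tendsto_natCast_atTop_atTop
  have hfg : (fun s => a (s + 1) - a s - L / (k + 1) * g s) =o[atTop] g := by
    rw [Asymptotics.isLittleO_iff_tendsto fun s hs => absurd hs (hgpos s).ne']
    have h1 := (h.div (tendsto_succ_pow_sub_pow_div k) hk).sub_const (L / (k + 1))
    rw [sub_self] at h1
    refine h1.congr fun s => ?_
    have hs : ((s + 1 : ℕ) : ℝ) ^ k ≠ 0 := by positivity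
    change (a (s + 1) - a s) / ((s + 1 : ℕ) : ℝ) ^ k / (g s / ((s + 1 : ℕ) : ℝ) ^ k) - _ = _
    rw [div_div_div_cancel_right₀ hs, sub_div _ (_ * _), mul_div_cancel_right₀ _ (hgpos s).ne']
  have hsum := hfg.sum_range (fun s => (hgpos s).le) (by simpa only [hgsum] using hpow)
  simp only [Finset.sum_sub_distrib _ (fun s => _ * g s), ← Finset.mul_sum, hgsum,
    Finset.sum_range_sub] at hsum
  have h2 := (hsum.tendsto_div_nhds_zero.add (hpow.const_div_atTop (a 0))).add_const (L / (k + 1))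
  rw [add_zero, zero_add] at h2
  refine h2.congr' ?_
  filter_upwards [eventually_ne_atTop 0] with s hs
  have : (s : ℝ) ≠ 0 := Nat.cast_ne_zero.2 hs
  field_simp
  ring

lemma tendsto_card_antidiagonalTuple (p : ℕ) :
    Tendsto (fun s : ℕ => ((antidiagonalTuple (p + 1) s).card : ℝ) / (s : ℝ) ^ p) atTop
      (𝓝 (1 / (p.factorial : ℝ))) := by
  induction p with
  | zero => simp
  | succ p ih =>
    have := tendsto_div_pow_succ_of_sub
      (a := fun s => ((antidiagonalTuple (p + 2) s).card : ℝ)) (k := p)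
      (L := 1 / (p.factorial : ℝ)) (by
        refine ((tendsto_add_atTop_iff_nat 1).2 ih).congr fun s => ?_
        rw [card_antidiagonalTuple_succ_succ (p + 1) s]
        push_cast
        ring)
    convert this using 2
    rw [Nat.factorial_succ]
    push_cast
    rw [div_div, mul_comm]

lemma tendsto_Nsum_div_pow (p q : ℕ) :
    Tendsto (fun s : ℕ => (Nsum p q s : ℝ) / (s : ℝ) ^ (p + q - 1)) atTop
      (𝓝 ((cRec p q : ℝ) / ((p + q - 1).factorial : ℝ))) := by
  induction p generalizing q with
  | zero =>
    rw [← tendsto_add_atTop_iff_nat 1]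
    simp [Nsum_zero_left, cRec]
  | succ p ihp =>
    induction q with
    | zero =>
      rw [← tendsto_add_atTop_iff_nat 1]
      simp [Nsum_zero_right, cRec]
    | succ q ihq =>
      have hlow : Tendsto (fun s : ℕ => (Nsum p q (s + 1) : ℝ) / ((s + 1 : ℕ) : ℝ) ^ (p + q))
          atTop (𝓝 0) := by
        rcases Nat.eq_zero_or_pos (p + q) with h0 | hpos
        · obtain rfl : p = 0 := by omega
          simp [Nsum_zero_left]
        · have h1 := ((tendsto_add_atTop_iff_nat 1).2 (ihp q)).mul
            ((tendsto_add_atTop_iff_nat 1).2 (tendsto_inv_atTop_nhds_zero_nat (𝕜 := ℝ)))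
          rw [mul_zero] at h1
          refine h1.congr fun s => ?_
          obtain ⟨m, hm⟩ := Nat.exists_eq_add_of_lt hpos
          rw [show p + q = m + 1 by omega, Nat.add_sub_cancel, pow_succ, div_mul_eq_div_div]
          rfl
      have hcard : Tendsto (fun s : ℕ => ((antidiagonalTuple (p + 1) s).card : ℝ) *
          ((antidiagonalTuple (q + 1) s).card : ℝ) / ((s + 1 : ℕ) : ℝ) ^ (p + q)) atTop
          (𝓝 (1 / (p.factorial : ℝ) * (1 / (q.factorial : ℝ)))) := by
        have h1 := ((tendsto_card_antidiagonalTuple p).mul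
          (tendsto_card_antidiagonalTuple q)).mul (tendsto_natCast_div_succ_pow (p + q))
        rw [mul_one] at h1
        refine h1.congr' ?_
        filter_upwards [eventually_ne_atTop 0] with s hs
        have : (s : ℝ) ≠ 0 := Nat.cast_ne_zero.2 hs
        have : ((s + 1 : ℕ) : ℝ) ≠ 0 := Nat.cast_ne_zero.2 s.succ_ne_zero
        rw [div_pow, pow_add (s : ℝ)]
        field_simp
      have hleft := (tendsto_add_atTop_iff_nat 1).2 (ihp (q + 1))
      have hright := (tendsto_add_atTop_iff_nat 1).2 ihq
      rw [show p + (q + 1) - 1 = p + q by omega] at hleft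
      rw [show p + 1 + q - 1 = p + q by omega] at hright
      have hdiff := ((hleft.add hright).sub hlow).add
        (hcard.const_mul (((p : ℤ) - (q : ℤ)).natAbs : ℝ))
      have main := tendsto_div_pow_succ_of_sub (a := fun s => (Nsum (p + 1) (q + 1) s : ℝ))
        (k := p + q) (hdiff.congr fun s => by
          have h := congrArg (Nat.cast : ℕ → ℝ) (Nsum_succ_succ p q s)
          simp only [Nat.cast_add (R := ℝ) (Nsum _ _ _), Nat.cast_add (R := ℝ) (_ + Nsum _ _ _),
            Nat.cast_mul] at h
          rw [eq_sub_of_add_eq h]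
          ring)
      rw [show p + 1 + (q + 1) - 1 = p + q + 1 by omega]
      convert main using 2
      have hc : ((p + q).choose p : ℝ) =
          (p + q).factorial / ((p.factorial : ℝ) * q.factorial) := by
        rw [Nat.cast_add_choose]
      rw [cRec, Nat.factorial_succ]
      push_cast
      rw [hc]
      have := Nat.cast_ne_zero (R := ℝ).2 (p + q).factorial_ne_zero
      have := Nat.cast_ne_zero (R := ℝ).2 p.factorial_ne_zero
      have := Nat.cast_ne_zero (R := ℝ).2 q.factorial_ne_zero
      have : (p + q + 1 : ℝ) ≠ 0 := by positivity
      field_simp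
      ring

/-- `N(p,q;s) / s^(p+q-1)` converges to `c(p,q)/(p+q-1)!` as `s → ∞`. -/
theorem Nsum_asymptotic (p q : ℕ) (hp : 1 ≤ p) (hq : 1 ≤ q) :
    Filter.Tendsto (fun s : ℕ => (Nsum p q s : ℝ) / (s : ℝ) ^ (p + q - 1))
      Filter.atTop (nhds ((cRec p q : ℝ) / (Nat.factorial (p + q - 1) : ℝ))) :=
  tendsto_Nsum_div_pow p q
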